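/- Let w ∈ W and let s₁⋯s_n be a reduced decomposition in (W_aff, S), and suppose w < w s₁ (Bruhat order). Then w s₂⋯s_n < w s₁ s₂⋯s_n, and q_{w s₁⋯s_n} · q_{w s₂⋯s_n}^{-1} = q_{s₁} · Π_{j=2}^{n} q_{s_j}^{2k_j} for some integers k_j ∈ {0,1}. -/

import Mathlib

/-! The extended affine Weyl group `W = Ω ⋉ W_aff` of a reduced based root datum:
`W_aff` is an (affine) Coxeter system `(W_aff, S)`, embedded in a group `W` by an
injective homomorphism `φ`, together with a subgroup `Ω` normalizing the simple
reflections such that every `w ∈ W` is uniquely `u·φ(w_aff)` with `u ∈ Ω`. -/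

section Extended

variable {Bt : Type*} {M : CoxeterMatrix Bt} {Wa : Type*} [Group Wa]
variable (cs : CoxeterSystem M Wa) {W : Type*} [Group W] (φ : Wa →* W) (Ω : Subgroup W)

/-- The Chevalley–Bruhat order on the Coxeter group `(W_aff, S)`: `x ≤ y` iff some
reduced expression of `y` admits a subword whose product is `x`. -/
def BruhatLE (x y : Wa) : Prop :=
  ∃ ω ω' : List Bt, cs.IsReduced ω ∧ cs.wordProd ω = y ∧
    ω'.Sublist ω ∧ cs.wordProd ω' = x

/-- The strict Chevalley–Bruhat order on `W_aff`. -/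
def BruhatLT (x y : Wa) : Prop := BruhatLE cs x y ∧ x ≠ y

/-- The strict Chevalley–Bruhat order on the extended group `W = Ω·W_aff`:
`u w_aff < u' w'_aff` iff `u = u'` and `w_aff < w'_aff`. -/
def ExtBruhatLT (w w' : W) : Prop :=
  ∃ (u : Ω) (a b : Wa), w = (u : W) * φ a ∧ w' = (u : W) * φ b ∧ BruhatLT cs a b

end Extended


namespace StrongExchange

variable {Bt : Type*} {M : CoxeterMatrix Bt} {Wa : Type*} [Group Wa]
variable (cs : CoxeterSystem M Wa)

open Classical in
/-- The action of a simple reflection on `W × ℤ/2`. -/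
noncomputable def act (i : Bt) : Function.End (Wa × ZMod 2) :=
  fun p => (cs.simple i * p.1 * cs.simple i, p.2 + if p.1 = cs.simple i then 1 else 0)

theorem conj_pow (i j : Bt) (m : ℕ) :
    cs.simple j * (cs.simple i * cs.simple j) ^ m * cs.simple j =
      ((cs.simple i * cs.simple j) ^ m)⁻¹ := by
  have h : cs.simple j * (cs.simple i * cs.simple j) * (cs.simple j)⁻¹
      = (cs.simple i * cs.simple j)⁻¹ := by
    simp [mul_assoc]
  calc _ = cs.simple j * (cs.simple i * cs.simple j) ^ m * (cs.simple j)⁻¹ := by simp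
    _ = _ := by rw [← _root_.conj_pow, h, inv_pow]

open Classical in
theorem act_pow (i j : Bt) (m : ℕ) (t : Wa) (e : ZMod 2) :
    ((act cs i * act cs j) ^ m) (t, e) =
      ((cs.simple i * cs.simple j) ^ m * t * ((cs.simple i * cs.simple j) ^ m)⁻¹,
        e + ∑ k ∈ Finset.range (2 * m),
          if t = cs.simple j * (cs.simple i * cs.simple j) ^ k then 1 else 0) := by
  induction m with
  | zero => simp; rfl
  | succ m ih =>
    rw [pow_succ']
    change act cs i (act cs j (((act cs i * act cs j) ^ m) (t, e))) = _
    rw [ih]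
    have hx := conj_pow cs i j m
    set x := (cs.simple i * cs.simple j) ^ m with hxdef
    have hj : cs.simple j * cs.simple j = 1 := cs.simple_mul_simple_self j
    have hi : cs.simple i * cs.simple i = 1 := cs.simple_mul_simple_self i
    have h1 : x * t * x⁻¹ = cs.simple j ↔
        t = cs.simple j * (cs.simple i * cs.simple j) ^ (2 * m) := by
      have : cs.simple j * (cs.simple i * cs.simple j) ^ (2 * m) = x⁻¹ * cs.simple j * x := by
        rw [← hx, two_mul, pow_add, ← hxdef]
        simp [mul_assoc]
      rw [this]
      constructor
      · intro h; rw [← h]; group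
      · intro h; rw [h]; group
    have h2 : cs.simple j * (x * t * x⁻¹) * cs.simple j = cs.simple i ↔
        t = cs.simple j * (cs.simple i * cs.simple j) ^ (2 * m + 1) := by
      have : cs.simple j * (cs.simple i * cs.simple j) ^ (2 * m + 1) =
          x⁻¹ * cs.simple j * cs.simple i * cs.simple j * x := by
        rw [← hx, two_mul, add_assoc, add_comm m 1, pow_add, pow_add, pow_one, ← hxdef]
        simp [mul_assoc]
      rw [this]
      constructor
      · intro h; rw [← h]; simp [mul_assoc]
      · intro h; rw [h]; simp [mul_assoc]
    simp only [act]
    rw [show 2 * (m + 1) = 2 * m + 1 + 1 by ring, Finset.sum_range_succ, Finset.sum_range_succ]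
    simp only [h1, h2]
    refine Prod.ext ?_ ?_
    · simp [mul_assoc, pow_succ', ← hxdef]
    · simp only [add_assoc]

theorem act_liftable : M.IsLiftable (act cs) := by
  classical
  intro i j
  funext ⟨t, e⟩
  rw [act_pow, cs.simple_mul_simple_pow, two_mul, Finset.sum_range_add]
  have : ∀ k, (cs.simple i * cs.simple j) ^ (M i j + k) = (cs.simple i * cs.simple j) ^ k := by
    intro k; rw [pow_add, cs.simple_mul_simple_pow, one_mul]
  simp only [this, CharTwo.add_self_eq_zero]
  simp; rfl

/-- The action of the Coxeter group on `W × ℤ/2`. -/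
noncomputable def actHom : Wa →* Function.End (Wa × ZMod 2) :=
  cs.lift ⟨act cs, act_liftable cs⟩

/-- The inversion cocycle. -/
noncomputable def eta (w t : Wa) : ZMod 2 := (actHom cs w (t, 0)).2

open Classical in
theorem actHom_simple (i : Bt) (t : Wa) (e : ZMod 2) : actHom cs (cs.simple i) (t, e) =
    (cs.simple i * t * cs.simple i, e + if t = cs.simple i then 1 else 0) := by
  rw [actHom, cs.lift_apply_simple]; rfl

theorem actHom_mul (x y : Wa) (p : Wa × ZMod 2) :
    actHom cs (x * y) p = actHom cs x (actHom cs y p) := by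
  rw [map_mul]; rfl

theorem actHom_one (p : Wa × ZMod 2) : actHom cs 1 p = p := by
  rw [map_one]; rfl

theorem actHom_apply (w t : Wa) (e : ZMod 2) :
    actHom cs w (t, e) = (w * t * w⁻¹, e + eta cs w t) := by
  classical
  induction w using cs.simple_induction_left generalizing t e with
  | one => simp [eta, actHom_one]
  | mul_simple_left w i ih =>
    rw [eta, actHom_mul, actHom_mul, ih, ih, actHom_simple, actHom_simple]
    simp [mul_assoc, add_assoc]

theorem eta_mul (x y t : Wa) : eta cs (x * y) t = eta cs y t + eta cs x (y * t * y⁻¹) := by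
  rw [eta, actHom_mul, actHom_apply, actHom_apply]; simp

theorem eta_one (t : Wa) : eta cs 1 t = 0 := by simp [eta, actHom_one]

theorem eta_simple (i : Bt) (t : Wa) [Decidable (t = cs.simple i)] :
    eta cs (cs.simple i) t = if t = cs.simple i then 1 else 0 := by
  classical
  rw [eta, actHom_simple]; simp

theorem mem_of_eta (ω : List Bt) (t : Wa) (h : eta cs (cs.wordProd ω) t ≠ 0) :
    t ∈ cs.rightInvSeq ω := by
  classical
  induction ω with
  | nil => simp [eta_one] at h
  | cons i ω ih =>
    rw [cs.wordProd_cons, eta_mul, eta_simple] at h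
    rw [CoxeterSystem.rightInvSeq, List.mem_cons]
    by_cases h1 : cs.wordProd ω * t * (cs.wordProd ω)⁻¹ = cs.simple i
    · left; rw [← h1]; group
    · right; rw [if_neg h1, add_zero] at h; exact ih h

theorem eta_self (t : Wa) (ht : cs.IsReflection t) : eta cs t t = 1 := by
  classical
  obtain ⟨w, i, rfl⟩ := ht
  have h := eta_mul cs w w⁻¹ (w * cs.simple i * w⁻¹)
  rw [mul_inv_cancel, eta_one] at h
  rw [eta_mul, eta_mul, eta_simple]
  have e1 : w⁻¹ * (w * cs.simple i * w⁻¹) * w⁻¹⁻¹ = cs.simple i := by group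
  rw [e1] at h ⊢
  have e2 : cs.simple i * cs.simple i * (cs.simple i)⁻¹ = cs.simple i := by group
  rw [e2, if_pos rfl, add_left_comm, ← h, add_zero]

theorem lt_of_eta_ne (w t : Wa) (h : eta cs w t ≠ 0) : cs.length (w * t) < cs.length w := by
  obtain ⟨ω, hω, rfl⟩ := cs.exists_isReduced w
  exact (cs.isRightInversion_of_mem_rightInvSeq hω (mem_of_eta cs ω t h)).2

theorem lt_of_eta_eq (w t : Wa) (ht : cs.IsReflection t) (h : eta cs w t = 0) :
    cs.length w < cs.length (w * t) := by
  have := lt_of_eta_ne cs (w * t) t (by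
    rw [eta_mul, eta_self cs t ht]; simp [h])
  rwa [mul_assoc, ht.mul_self, mul_one] at this

theorem eta_eq_zero_iff (w t : Wa) (ht : cs.IsReflection t) :
    eta cs w t = 0 ↔ cs.length w < cs.length (w * t) :=
  ⟨lt_of_eta_eq cs w t ht, fun h => by
    by_contra hne; exact lt_asymm h (lt_of_eta_ne cs w t hne)⟩

/-- Strong exchange. -/
theorem strong_exchange (x t : Wa) (ht : cs.IsReflection t)
    (h : cs.length x < cs.length (x * t)) (ω : List Bt) (hω : cs.wordProd ω = x * t) :
    ∃ (α β : List Bt) (r : Bt), ω = α ++ r :: β ∧ x = cs.wordProd (α ++ β) ∧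
      t = (cs.wordProd β)⁻¹ * cs.simple r * cs.wordProd β := by
  have h1 : t ∈ cs.rightInvSeq ω := by
    apply mem_of_eta
    rw [hω]
    intro h0
    have := lt_of_eta_eq cs _ t ht h0
    rw [mul_assoc, ht.mul_self, mul_one] at this
    exact lt_asymm h this
  have hx : x = cs.wordProd ω * t := by rw [hω, mul_assoc, ht.mul_self, mul_one]
  clear hω h
  induction ω generalizing x with
  | nil => simp at h1
  | cons i ω ih =>
    rw [CoxeterSystem.rightInvSeq, List.mem_cons] at h1
    rcases h1 with h1 | h1
    · refine ⟨[], ω, i, rfl, ?_, h1⟩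
      rw [hx, h1, cs.wordProd_cons]
      simp [mul_assoc]
    · obtain ⟨α, β, r, e1, e2, e3⟩ := ih (cs.wordProd ω * t) h1 rfl
      refine ⟨i :: α, β, r, by rw [e1]; rfl, ?_, e3⟩
      rw [List.cons_append, cs.wordProd_cons, ← e2, hx, cs.wordProd_cons, mul_assoc]

variable {V : Type*} (v : Bt → V) (N : Wa → Multiset V)

theorem weight_up (hN : ∀ ω, cs.IsReduced ω → N (cs.wordProd ω) = (ω.map v : Multiset V))
    (x : Wa) (i : Bt) (h : cs.length (x * cs.simple i) = cs.length x + 1) :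
    N (x * cs.simple i) = N x + {v i} := by
  obtain ⟨ω, hω, rfl⟩ := cs.exists_isReduced x
  have e : cs.wordProd ω * cs.simple i = cs.wordProd (ω ++ [i]) := by
    simp [cs.wordProd_append]
  have hr : cs.IsReduced (ω ++ [i]) := by
    unfold CoxeterSystem.IsReduced
    rw [← e, h, hω.eq]; simp
  rw [e, hN _ hr, hN _ hω]
  simp [← Multiset.coe_add]

theorem weight_down (hN : ∀ ω, cs.IsReduced ω → N (cs.wordProd ω) = (ω.map v : Multiset V))
    (x : Wa) (i : Bt) (h : cs.length (x * cs.simple i) + 1 = cs.length x) :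
    N x = N (x * cs.simple i) + {v i} := by
  have := weight_up cs v N hN (x * cs.simple i) i (by simp [h])
  simpa using this

theorem weight_word (hN : ∀ ω, cs.IsReduced ω → N (cs.wordProd ω) = (ω.map v : Multiset V))
    (ω : List Bt) : ∃ K : Multiset V, (ω.map v : Multiset V) = N (cs.wordProd ω) + (K + K) := by
  induction ω using List.reverseRecOn with
  | nil =>
    refine ⟨0, ?_⟩
    rw [hN [] (by simp [CoxeterSystem.IsReduced])]; simp
  | append_singleton ω i ih =>
    obtain ⟨K, hK⟩ := ih
    have e : cs.wordProd (ω ++ [i]) = cs.wordProd ω * cs.simple i := by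
      simp [cs.wordProd_append]
    have e2 : ((ω ++ [i]).map v : Multiset V) = (ω.map v : Multiset V) + {v i} := by
      simp [← Multiset.coe_add]
    rw [e, e2, hK]
    rcases cs.length_mul_simple (cs.wordProd ω) i with h | h
    · exact ⟨K, by rw [weight_up cs v N hN _ _ h]; abel⟩
    · exact ⟨K + {v i}, by rw [weight_down cs v N hN _ _ h]; abel⟩

theorem weight_refl (hN : ∀ ω, cs.IsReduced ω → N (cs.wordProd ω) = (ω.map v : Multiset V))
    (hv : ∀ i j, (∃ c, c * cs.simple i * c⁻¹ = cs.simple j) → v i = v j)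
    (x c : Wa) (i : Bt) (h : cs.length x < cs.length (x * (c * cs.simple i * c⁻¹))) :
    ∃ K : Multiset V, N (x * (c * cs.simple i * c⁻¹)) = N x + {v i} + (K + K) := by
  obtain ⟨ω, hω, hω2⟩ := cs.exists_isReduced (x * (c * cs.simple i * c⁻¹))
  obtain ⟨α, β, r, e1, e2, e3⟩ := strong_exchange cs x _ ⟨c, i, rfl⟩ h ω hω2.symm
  have hvr : v i = v r := hv _ _ ⟨cs.wordProd β * c, by
    calc _ = cs.wordProd β * (c * cs.simple i * c⁻¹) * (cs.wordProd β)⁻¹ := by group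
      _ = _ := by rw [e3]; group⟩
  obtain ⟨K, hK⟩ := weight_word cs v N hN (α ++ β)
  refine ⟨K, ?_⟩
  rw [hω2, hN _ hω, e1, hvr, e2]
  have : ((α ++ r :: β).map v : Multiset V) = ((α ++ β).map v : Multiset V) + {v r} := by
    simp only [List.map_append, List.map_cons, ← Multiset.coe_add, ← Multiset.cons_coe,
      ← Multiset.singleton_add]
    abel
  rw [this, hK]; abel

theorem length_lt (a : Wa) (i : Bt) (ω : List Bt) (hred : cs.IsReduced (i :: ω))
    (ha : cs.length a < cs.length (a * cs.simple i)) :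
    cs.length (a * cs.wordProd ω) < cs.length (a * cs.wordProd ω *
      ((cs.wordProd ω)⁻¹ * cs.simple i * (cs.wordProd ω)⁻¹⁻¹)) := by
  have ht : cs.IsReflection ((cs.wordProd ω)⁻¹ * cs.simple i * (cs.wordProd ω)⁻¹⁻¹) :=
    ⟨_, i, rfl⟩
  rw [← eta_eq_zero_iff cs _ _ ht, eta_mul]
  have h1 : eta cs (cs.wordProd ω)
      ((cs.wordProd ω)⁻¹ * cs.simple i * (cs.wordProd ω)⁻¹⁻¹) = 0 := by
    rw [eta_eq_zero_iff cs _ _ ht]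
    have e : cs.wordProd ω * ((cs.wordProd ω)⁻¹ * cs.simple i * (cs.wordProd ω)⁻¹⁻¹) =
      cs.wordProd (i :: ω) := by rw [cs.wordProd_cons]; group
    rw [e, hred.eq]
    have := cs.length_wordProd_le ω
    simp; omega
  have e : cs.wordProd ω * ((cs.wordProd ω)⁻¹ * cs.simple i * (cs.wordProd ω)⁻¹⁻¹) *
      (cs.wordProd ω)⁻¹ = cs.simple i := by group
  rw [h1, e, (eta_eq_zero_iff cs a _ (cs.isReflection_simple i)).2 ha, add_zero]

theorem conj_eq (a : Wa) (i : Bt) (ω : List Bt) :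
    a * cs.wordProd ω * ((cs.wordProd ω)⁻¹ * cs.simple i * (cs.wordProd ω)⁻¹⁻¹) =
      a * cs.wordProd (i :: ω) := by
  rw [cs.wordProd_cons]; group

theorem main_weight (hN : ∀ ω, cs.IsReduced ω → N (cs.wordProd ω) = (ω.map v : Multiset V))
    (hv : ∀ i j, (∃ c, c * cs.simple i * c⁻¹ = cs.simple j) → v i = v j)
    (a : Wa) (i : Bt) (ha : cs.length a < cs.length (a * cs.simple i))
    (ω : List Bt) (hred : cs.IsReduced (i :: ω)) :
    ∃ σ : List Bt, σ.Sublist ω ∧ N (a * cs.wordProd (i :: ω)) =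
      N (a * cs.wordProd ω) + {v i} + ((σ.map v : Multiset V) + (σ.map v : Multiset V)) := by
  induction ω using List.reverseRecOn with
  | nil =>
    refine ⟨[], by simp, ?_⟩
    have := weight_up cs v N hN a i (by rcases cs.length_mul_simple a i with h | h <;> omega)
    simpa using this
  | append_singleton ω j ih =>
    have hred' : cs.IsReduced (i :: ω) := by
      have := hred.take (ω.length + 1)
      simpa using this
    obtain ⟨σ, hσ, hE⟩ := ih hred'
    have hlt := length_lt cs a i (ω ++ [j]) hred ha
    obtain ⟨K, hK⟩ := weight_refl cs v N hN hv _ _ _ hlt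
    rw [conj_eq] at hK
    have e1 : a * cs.wordProd (ω ++ [j]) = a * cs.wordProd ω * cs.simple j := by
      simp [cs.wordProd_append, mul_assoc]
    have e2 : a * cs.wordProd (i :: (ω ++ [j])) = a * cs.wordProd (i :: ω) * cs.simple j := by
      simp [cs.wordProd_append, cs.wordProd_cons, mul_assoc]
    rw [e1, e2] at hK ⊢
    generalize a * cs.wordProd ω = x at *
    generalize a * cs.wordProd (i :: ω) = y at *
    have hσ' : σ.Sublist (ω ++ [j]) := hσ.trans (List.sublist_append_left _ _)
    rcases cs.length_mul_simple x j with hx | hx <;> rcases cs.length_mul_simple y j with hy | hy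
    · refine ⟨σ, hσ', ?_⟩
      rw [weight_up cs v N hN _ _ hx, weight_up cs v N hN _ _ hy, hE]; abel
    · have hx' := weight_up cs v N hN _ _ hx
      have hy' := weight_down cs v N hN _ _ hy
      have key : (σ.map v : Multiset V) + (σ.map v : Multiset V) =
          {v j} + {v j} + (K + K) := by
        rw [hE, hK, hx'] at hy'
        have : N x + {v i} + ((σ.map v : Multiset V) + (σ.map v : Multiset V)) =
          N x + {v i} + ({v j} + {v j} + (K + K)) := by rw [hy']; abel
        exact add_left_cancel this
      have hmem : v j ∈ σ.map v := by
        have : v j ∈ (σ.map v : Multiset V) + (σ.map v : Multiset V) := by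
          rw [key]; simp
        simpa using this
      obtain ⟨r, hr, hrv⟩ := List.mem_map.1 hmem
      obtain ⟨α, β, rfl⟩ := List.append_of_mem hr
      refine ⟨α ++ β, List.Sublist.trans ?_ hσ', ?_⟩
      · exact List.Sublist.append_left (List.sublist_cons_self _ _) _
      · have h3 : ((α ++ r :: β).map v : Multiset V) = ((α ++ β).map v : Multiset V) + {v j} := by
          rw [← hrv]
          simp only [List.map_append, List.map_cons, ← Multiset.coe_add, ← Multiset.cons_coe,
            ← Multiset.singleton_add]
          abel
        apply add_right_cancel (b := {v j})
        rw [← hy', hE, hx', h3]; abel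
    · refine ⟨σ ++ [j], hσ.append (List.Sublist.refl _), ?_⟩
      have h3 : ((σ ++ [j]).map v : Multiset V) = (σ.map v : Multiset V) + {v j} := by
        simp [← Multiset.coe_add]
      rw [weight_up cs v N hN _ _ hy, hE, weight_down cs v N hN _ _ hx, h3]; abel
    · refine ⟨σ, hσ', ?_⟩
      apply add_right_cancel (b := {v j})
      rw [← weight_down cs v N hN _ _ hy, hE, weight_down cs v N hN _ _ hx]; abel

theorem sublist_to_k {R : Type*} [CommMonoid R] (f : Bt → R) (σ ω : List Bt)
    (h : σ.Sublist ω) : ∃ k : List ℕ, k.length = ω.length ∧ (∀ a ∈ k, a ≤ 1) ∧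
      (σ.map f).prod * (σ.map f).prod = ((ω.zip k).map (fun p => f p.1 ^ (2 * p.2))).prod := by
  induction h with
  | slnil => exact ⟨[], by simp⟩
  | cons b _ ih =>
    obtain ⟨k, h1, h2, h3⟩ := ih
    exact ⟨0 :: k, by simp [h1], by simpa using h2, by simp [h3]⟩
  | cons_cons b _ ih =>
    obtain ⟨k, h1, h2, h3⟩ := ih
    refine ⟨1 :: k, by simp [h1], by simpa using h2, ?_⟩
    simp only [List.map_cons, List.prod_cons, List.zip_cons_cons, ← h3, mul_one, sq]
    exact mul_mul_mul_comm _ _ _ _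

theorem prod_X_inj {V : Type*} (l l' : Multiset V)
    (h : (l.map (fun a => (MvPolynomial.X a : MvPolynomial V ℤ))).prod =
      (l'.map (fun a => (MvPolynomial.X a : MvPolynomial V ℤ))).prod) : l = l' := by
  classical
  have key : ∀ l : Multiset V, (l.map (fun a => (MvPolynomial.X a : MvPolynomial V ℤ))).prod =
      MvPolynomial.monomial (Multiset.toFinsupp l) 1 := by
    intro l
    induction l using Multiset.induction_on with
    | empty => simp
    | cons a l ih =>
      rw [Multiset.map_cons, Multiset.prod_cons, ih, ← Multiset.singleton_add, map_add,
        Multiset.toFinsupp_singleton, MvPolynomial.X, MvPolynomial.monomial_mul, one_mul]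
  rw [key, key] at h
  exact Multiset.toFinsupp.injective (MvPolynomial.monomial_left_injective one_ne_zero h)

theorem bruhatLT_of_lt (x t : Wa) (ht : cs.IsReflection t)
    (h : cs.length x < cs.length (x * t)) : BruhatLT cs x (x * t) := by
  obtain ⟨ω, hω, hω2⟩ := cs.exists_isReduced (x * t)
  obtain ⟨α, β, r, e1, e2, -⟩ := strong_exchange cs x t ht h ω hω2.symm
  refine ⟨⟨ω, α ++ β, hω, hω2.symm, ?_, e2.symm⟩, fun e => ?_⟩
  · rw [e1]; exact List.Sublist.append_left (List.sublist_cons_self _ _) _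
  · rw [← e] at h; exact lt_irrefl _ h

theorem length_le_of_bruhatLE (x y : Wa) (h : BruhatLE cs x y) : cs.length x ≤ cs.length y := by
  obtain ⟨ω, ω', h1, rfl, h3, rfl⟩ := h
  rw [h1.eq]
  exact (cs.length_wordProd_le ω').trans h3.length_le

end StrongExchange

/-- Let `w ∈ W` and let `s₁⋯s_n` (here the word `i :: ω`) be a reduced
decomposition in `(W_aff, S)` with `w < w s₁` in the Bruhat order.  Then
`w s₂⋯s_n < w s₁ s₂⋯s_n`, and
`q_{w s₁⋯s_n} = q_{w s₂⋯s_n} · q_{s₁} · Π_{j=2}^n q_{s_j}^{2 k_j}` for some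
integers `k_j ∈ {0,1}`. -/
theorem stmt_16 {Bt : Type*} {M : CoxeterMatrix Bt} {Wa : Type*} [Group Wa]
    (cs : CoxeterSystem M Wa) {W : Type*} [Group W] (φ : Wa →* W) (Ω : Subgroup W)
    (hφ : Function.Injective φ)
    (hdec : ∀ w : W, ∃! p : Ω × Wa, w = (p.1 : W) * φ p.2)
    (hnorm : ∀ u : Ω, ∀ i : Bt, ∃ j : Bt,
      (u : W) * φ (cs.simple i) * (u : W)⁻¹ = φ (cs.simple j))
    {V : Type*} (v : Bt → V)
    (hv : ∀ i j : Bt, (∃ w : W, w * φ (cs.simple i) * w⁻¹ = φ (cs.simple j)) →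
      v i = v j)
    (q : W → MvPolynomial V ℤ)
    (hq : ∀ (w : W) (u u' : Ω) (ω : List Bt), cs.IsReduced ω →
      w = (u : W) * φ (cs.wordProd ω) * (u' : W) →
      q w = (ω.map (fun i => MvPolynomial.X (v i))).prod)
    (w : W) (i : Bt) (ω : List Bt) (hred : cs.IsReduced (i :: ω))
    (hlt : ExtBruhatLT cs φ Ω w (w * φ (cs.simple i))) :
    ExtBruhatLT cs φ Ω (w * φ (cs.wordProd ω)) (w * φ (cs.wordProd (i :: ω))) ∧
    ∃ k : List ℕ, k.length = ω.length ∧ (∀ a ∈ k, a ≤ 1) ∧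
      q (w * φ (cs.wordProd (i :: ω))) =
        q (w * φ (cs.wordProd ω)) * MvPolynomial.X (v i) *
          ((ω.zip k).map (fun p => MvPolynomial.X (v p.1) ^ (2 * p.2))).prod := by
  obtain ⟨u, a, b, rfl, hb, hab⟩ := hlt
  have hb' : b = a * cs.simple i := by
    apply hφ
    rw [map_mul]
    rw [mul_assoc] at hb
    exact (mul_left_cancel hb).symm
  subst hb'
  have ha : cs.length a < cs.length (a * cs.simple i) :=
    lt_of_le_of_ne (StrongExchange.length_le_of_bruhatLE cs _ _ hab.1)
      (cs.length_mul_simple_ne a i).symm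
  have hlen := StrongExchange.length_lt cs a i ω hred ha
  have hB := StrongExchange.bruhatLT_of_lt cs _ _ ⟨_, i, rfl⟩ hlen
  rw [StrongExchange.conj_eq] at hB
  refine ⟨⟨u, _, _, by rw [map_mul, mul_assoc], by rw [map_mul, mul_assoc], hB⟩, ?_⟩
  have hv' : ∀ i j, (∃ c, c * cs.simple i * c⁻¹ = cs.simple j) → v i = v j := by
    rintro i j ⟨c, hc⟩
    exact hv i j ⟨φ c, by rw [← hc]; simp⟩
  choose red hred1 hred2 using cs.exists_isReduced
  have hqm : ∀ (u : Ω) (ω : List Bt), cs.IsReduced ω → q ((u : W) * φ (cs.wordProd ω)) =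
      (((ω.map v : Multiset V)).map
        (fun a => (MvPolynomial.X a : MvPolynomial V ℤ))).prod := by
    intro u ω hω
    rw [hq _ u 1 ω hω (by simp)]
    simp [Function.comp_def]
  obtain ⟨N, hNdef⟩ : ∃ N : Wa → Multiset V, ∀ x, N x = ((red x).map v : Multiset V) :=
    ⟨_, fun _ => rfl⟩
  have hN : ∀ ω, cs.IsReduced ω → N (cs.wordProd ω) = (ω.map v : Multiset V) := by
    intro ω hω
    rw [hNdef]
    apply StrongExchange.prod_X_inj
    rw [← hqm 1 _ hω, ← hqm 1 _ (hred1 _), ← hred2]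
  have hqN : ∀ x : Wa, q ((u : W) * φ x) =
      ((N x).map (fun a => (MvPolynomial.X a : MvPolynomial V ℤ))).prod := by
    intro x
    rw [hNdef, ← hqm u _ (hred1 _), ← hred2]
  obtain ⟨σ, hσ, hE⟩ := StrongExchange.main_weight cs v N hN hv' a i ha ω hred
  obtain ⟨k, h1, h2, h3⟩ := StrongExchange.sublist_to_k
    (fun b => (MvPolynomial.X (v b) : MvPolynomial V ℤ)) σ ω hσ
  refine ⟨k, h1, h2, ?_⟩
  rw [mul_assoc, ← map_mul, mul_assoc (u : W), ← map_mul, hqN, hqN, hE, ← h3]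
  simp [Function.comp_def]
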